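/- Let X be a topological space and F a family of bounded continuous real-valued functions on X that admits a countable subset dense in F for the sup norm. Then the Banach space C(K,ℝ) of continuous real-valued functions on K := e_F X (the closure of the range of the evaluation map e_F, which is compact) equipped with the sup norm is separable. -/

import Mathlib

open BoundedContinuousFunction

/-- The evaluation map of a family of bounded continuous functions has relatively compact range. -/
lemma isCompact_closure_range_eval {X : Type*} [TopologicalSpace X]
    (F : Set (BoundedContinuousFunction X ℝ)) :
    IsCompact (closure (Set.range
      fun (x : X) (f : F) => (f : BoundedContinuousFunction X ℝ) x)) := by
  have hbox : IsCompact (Set.univ.pi fun f : F =>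
      Metric.closedBall (0 : ℝ) ‖(f : BoundedContinuousFunction X ℝ)‖) :=
    isCompact_univ_pi fun f => isCompact_closedBall _ _
  refine hbox.closure_of_subset ?_
  rintro _ ⟨x, rfl⟩ f -
  simpa using (f : BoundedContinuousFunction X ℝ).norm_coe_le_norm x

/-- On the closure of the range of the evaluation map, the coordinates depend on the function in a
`1`-Lipschitz way. -/
lemma abs_sub_le_norm_sub_of_mem_closure_range_eval {X : Type*} [TopologicalSpace X]
    {F : Set (BoundedContinuousFunction X ℝ)} {y : F → ℝ}
    (hy : y ∈ closure (Set.range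
      fun (x : X) (f : F) => (f : BoundedContinuousFunction X ℝ) x)) (f g : F) :
    |y f - y g| ≤ ‖(f : BoundedContinuousFunction X ℝ) - g‖ := by
  have hclosed : IsClosed {z : F → ℝ | |z f - z g| ≤
      ‖(f : BoundedContinuousFunction X ℝ) - g‖} :=
    isClosed_le (by fun_prop) continuous_const
  refine closure_minimal ?_ hclosed hy
  rintro _ ⟨x, rfl⟩
  exact ((f : BoundedContinuousFunction X ℝ) - g).norm_coe_le_norm x

/-- The compactification attached to a separable family of bounded continuous functions is second
countable. -/
lemma secondCountableTopology_closure_range_eval {X : Type*} [TopologicalSpace X]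
    {F D : Set (BoundedContinuousFunction X ℝ)} (hDF : D ⊆ F) (hD : D.Countable)
    (hdense : ∀ f ∈ F, ∀ ε > (0 : ℝ), ∃ g ∈ D, ‖f - g‖ < ε) :
    SecondCountableTopology (closure (Set.range
      fun (x : X) (f : F) => (f : BoundedContinuousFunction X ℝ) x)) := by
  set K := closure (Set.range fun (x : X) (f : F) => (f : BoundedContinuousFunction X ℝ) x)
  have : CompactSpace K := isCompact_iff_compactSpace.mp (isCompact_closure_range_eval F)
  have : Countable D := hD.to_subtype
  let r : K → D → ℝ := fun y g => y.1 ⟨g, hDF g.2⟩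
  have hr : Continuous r :=
    continuous_pi fun g => (continuous_apply _).comp continuous_subtype_val
  have hinj : Function.Injective r := by
    intro y z hyz
    ext f
    refine eq_of_forall_dist_le fun ε hε => ?_
    obtain ⟨g, hg, hfg⟩ := hdense f f.2 (ε / 2) (half_pos hε)
    have hy := abs_sub_le_norm_sub_of_mem_closure_range_eval y.2 f ⟨g, hDF hg⟩
    have hz := abs_sub_le_norm_sub_of_mem_closure_range_eval z.2 f ⟨g, hDF hg⟩
    have hyzg : y.1 ⟨g, hDF hg⟩ = z.1 ⟨g, hDF hg⟩ := congrFun hyz ⟨g, hg⟩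
    rw [Real.dist_eq]
    rw [abs_le] at hy hz ⊢
    constructor <;> linarith
  exact (hr.isClosedEmbedding hinj).isEmbedding.secondCountableTopology

/-- If `F ⊆ BC(X,ℝ)` admits a countable sup-norm-dense subset, then the space of
continuous functions on the compactification `K = e_F X` (which is compact) is separable
for the sup norm. -/
theorem continuousFunctions_on_compactification_separable {X : Type*} [TopologicalSpace X]
    (F : Set (BoundedContinuousFunction X ℝ))
    (hFsep : ∃ D₀ : Set (BoundedContinuousFunction X ℝ), D₀ ⊆ F ∧ D₀.Countable ∧
      ∀ f ∈ F, ∀ ε > (0 : ℝ), ∃ g ∈ D₀, ‖f - g‖ < ε) :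
    letI e : X → (F → ℝ) := fun x f => (f : BoundedContinuousFunction X ℝ) x
    IsCompact (closure (Set.range e)) ∧
      ∃ D : Set (ContinuousMap ↥(closure (Set.range e)) ℝ), D.Countable ∧
        ∀ h : ContinuousMap ↥(closure (Set.range e)) ℝ, ∀ ε > (0 : ℝ),
          ∃ h' ∈ D, ∀ y, |h y - h' y| < ε := by
  have hK := isCompact_closure_range_eval F
  obtain ⟨D₀, hDF, hD, hdense⟩ := hFsep
  have := secondCountableTopology_closure_range_eval hDF hD hdense
  have := isCompact_iff_compactSpace.mp hK
  refine ⟨hK, ?_⟩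
  obtain ⟨D, hDc, hDd⟩ := TopologicalSpace.exists_countable_dense
    C(closure (Set.range fun (x : X) (f : F) => (f : BoundedContinuousFunction X ℝ) x), ℝ)
  refine ⟨D, hDc, fun h ε hε => ?_⟩
  obtain ⟨h', hh', hlt⟩ := hDd.exists_dist_lt h hε
  exact ⟨h', hh', fun y => (ContinuousMap.dist_apply_le_dist y).trans_lt hlt⟩
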